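/- For every i with 1 ≤ i ≤ N−1 and every partition λ = (λ_1 ≥ … ≥ λ_i ≥ 0) with λ_{i+1} = … = λ_{N−1} = 0, one has [H, B⁺_i] φ_λ = B⁺_i ( 2 Σ_{j=1}^{N−1} λ_j + i + β i(N−i) ) φ_λ, where [H, B⁺_i] φ_λ = H(B⁺_i φ_λ) − B⁺_i(H φ_λ). -/

import Mathlib

open MvPolynomial Finset

section CSDefs

variable {F : Type*} [Field F] [CharZero F]

/-- Exact division in a polynomial ring: `divExact d f = f / d` when `d ∣ f`, junk otherwise. -/
noncomputable def divExact {σ : Type*} (d f : MvPolynomial σ F) : MvPolynomial σ F := by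
  classical exact if h : ∃ c, f = d * c then h.choose else 0

/-- The exchange operator `K_{ij}` permuting the variables `z_i` and `z_j`. -/
noncomputable def Kswap {N : ℕ} (i j : Fin N) (f : MvPolynomial (Fin N) F) :
    MvPolynomial (Fin N) F :=
  rename (Equiv.swap i j) f

/-- The Dunkl operator `∇_i = ∂_i + β ∑_{j ≠ i} (z_i - z_j)⁻¹ (1 - K_{ij})`. -/
noncomputable def nabla {N : ℕ} (β : F) (i : Fin N) (f : MvPolynomial (Fin N) F) :
    MvPolynomial (Fin N) F :=
  pderiv i f + β • ∑ j ∈ Finset.univ.erase i, divExact (X i - X j) (f - Kswap i j f)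

/-- `D_i = z_i ∇_i`. -/
noncomputable def Dop {N : ℕ} (β : F) (i : Fin N) (f : MvPolynomial (Fin N) F) :
    MvPolynomial (Fin N) F :=
  X i * nabla β i f

/-- `(D_{j₁} + kβ)(D_{j₂} + (k+1)β) ⋯` applied along a list of indices. -/
noncomputable def Dlist {N : ℕ} (β : F) :
    ℕ → List (Fin N) → MvPolynomial (Fin N) F → MvPolynomial (Fin N) F
  | _, [], f => f
  | k, j :: rest, f => Dop β j (Dlist β (k + 1) rest f) + ((k : F) * β) • Dlist β (k + 1) rest f

/-- `D_{k,J} = (D_{j₁} + kβ)(D_{j₂} + (k+1)β) ⋯ (D_{j_ℓ} + (k+ℓ-1)β)` for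
`J = {j₁ < j₂ < … < j_ℓ}`. -/
noncomputable def DJ {N : ℕ} (β : F) (k : ℕ) (J : Finset (Fin N))
    (f : MvPolynomial (Fin N) F) : MvPolynomial (Fin N) F :=
  Dlist β k (J.sort (· ≤ ·)) f

/-- `z_J = ∏_{i ∈ J} z_i`. -/
noncomputable def zJ {N : ℕ} (J : Finset (Fin N)) : MvPolynomial (Fin N) F := ∏ i ∈ J, X i

/-- The creation operator `B⁺_{i,J} = ∑_{J' ⊆ J, |J'| = i} z_{J'} D_{1,J'}`. -/
noncomputable def Bplus {N : ℕ} (β : F) (i : ℕ) (J : Finset (Fin N))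
    (f : MvPolynomial (Fin N) F) : MvPolynomial (Fin N) F :=
  ∑ J' ∈ J.powersetCard i, zJ J' * DJ β 1 J' f

/-- `A_{ij} = ((z_i+z_j)/(z_i-z_j))(z_i ∂_i - z_j ∂_j)`. -/
noncomputable def Aop {N : ℕ} (i j : Fin N) (f : MvPolynomial (Fin N) F) :
    MvPolynomial (Fin N) F :=
  divExact (X i - X j) ((X i + X j) * (X i * pderiv i f - X j * pderiv j f))

/-- `H^{(S)} = ∑_{i ∈ S} (z_i ∂_i)² + β ∑_{i<j, i,j ∈ S} A_{ij}`. -/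
noncomputable def Hop {N : ℕ} (β : F) (S : Finset (Fin N)) (f : MvPolynomial (Fin N) F) :
    MvPolynomial (Fin N) F :=
  ∑ i ∈ S, X i * pderiv i (X i * pderiv i f)
    + β • ∑ i ∈ S, ∑ j ∈ S.filter (fun j => i < j), Aop i j f

/-- A polynomial is symmetric in the variables indexed by `S`. -/
def SymmOn {N : ℕ} (S : Finset (Fin N)) (f : MvPolynomial (Fin N) F) : Prop :=
  ∀ i ∈ S, ∀ j ∈ S, rename (Equiv.swap i j) f = f

/-- `phiCS β N lam i = (B⁺_i)^{λ_i - λ_{i+1}} ⋯ (B⁺_1)^{λ_1 - λ_2} · 1`,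
where `lam` is 0-indexed: `lam (j-1) = λ_j`. -/
noncomputable def phiCS (β : F) (N : ℕ) (lam : ℕ → ℕ) : ℕ → MvPolynomial (Fin N) F
  | 0 => 1
  | i + 1 => (fun f => Bplus β (i + 1) Finset.univ f)^[lam i - lam (i + 1)] (phiCS β N lam i)

/-- The monomial symmetric polynomial attached to an exponent vector. -/
noncomputable def msym (N : ℕ) (lam : Fin N → ℕ) : MvPolynomial (Fin N) F := by
  classical
  exact ∑ v ∈ (Finset.univ : Finset (Equiv.Perm (Fin N))).image
      (fun σ => fun i => lam (σ i)), ∏ i, X i ^ v i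

/-- `𝐷̂_i = D_i + β(i-1) - β ∑_{j<i} (1 - K_{ij})` (0-indexed: `i-1` becomes `i`). -/
noncomputable def Dhat {N : ℕ} (β : F) (i : Fin N) (f : MvPolynomial (Fin N) F) :
    MvPolynomial (Fin N) F :=
  Dop β i f + (β * ((i : ℕ) : F)) • f
    - β • ∑ j ∈ Finset.univ.filter (fun j => j < i), (f - Kswap i j f)

end CSDefs

section DividedDifference

variable {F : Type*} [Field F] {N : ℕ}

theorem divExact_eq_of_eq_mul {σ : Type*} {d f c : MvPolynomial σ F} (hd : d ≠ 0)
    (h : f = d * c) : divExact d f = c := by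
  have hex : ∃ c, f = d * c := ⟨c, h⟩
  have : divExact d f = hex.choose := by
    unfold divExact
    rw [dif_pos hex]
  rw [this]
  exact mul_left_cancel₀ hd (hex.choose_spec.symm.trans h)

theorem X_sub_X_ne_zero {i j : Fin N} (h : i ≠ j) :
    (X i - X j : MvPolynomial (Fin N) F) ≠ 0 :=
  sub_ne_zero.2 fun h' => h (X_injective h')

theorem X_sub_X_dvd_sub_Kswap (i j : Fin N) (f : MvPolynomial (Fin N) F) :
    (X i - X j : MvPolynomial (Fin N) F) ∣ f - Kswap i j f := by
  rw [← Ideal.mem_span_singleton, ← Ideal.Quotient.eq]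
  set I := Ideal.span {(X i - X j : MvPolynomial (Fin N) F)}
  have hij : Ideal.Quotient.mk I (X i) = Ideal.Quotient.mk I (X j) :=
    Ideal.Quotient.eq.2 (Ideal.mem_span_singleton_self _)
  have h : Ideal.Quotient.mkₐ F I = (Ideal.Quotient.mkₐ F I).comp (rename (Equiv.swap i j)) := by
    ext k
    simp only [Ideal.Quotient.mkₐ_eq_mk, AlgHom.comp_apply, rename_X]
    rcases eq_or_ne k i with rfl | hki
    · simpa using hij
    · rcases eq_or_ne k j with rfl | hkj
      · simpa using hij.symm
      · rw [Equiv.swap_apply_of_ne_of_ne hki hkj]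
  exact DFunLike.congr_fun h f

/-- The divided difference `(z_i - z_j)⁻¹ (1 - K_{ij})`. -/
noncomputable def divDiff (i j : Fin N) (f : MvPolynomial (Fin N) F) : MvPolynomial (Fin N) F :=
  divExact (X i - X j) (f - Kswap i j f)

theorem divDiff_eq {i j : Fin N} (h : i ≠ j) {f c : MvPolynomial (Fin N) F}
    (hc : f - rename (Equiv.swap i j) f = (X i - X j) * c) : divDiff i j f = c :=
  divExact_eq_of_eq_mul (X_sub_X_ne_zero h) hc

theorem sub_rename_swap {i j : Fin N} (h : i ≠ j) (f : MvPolynomial (Fin N) F) :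
    f - rename (Equiv.swap i j) f = (X i - X j) * divDiff i j f := by
  obtain ⟨c, hc⟩ := X_sub_X_dvd_sub_Kswap i j f
  rw [divDiff_eq h hc]
  exact hc

theorem divDiff_add {i j : Fin N} (h : i ≠ j) (f g : MvPolynomial (Fin N) F) :
    divDiff i j (f + g) = divDiff i j f + divDiff i j g := by
  apply divDiff_eq h
  rw [map_add, mul_add, ← sub_rename_swap h, ← sub_rename_swap h]
  ring

theorem divDiff_smul {i j : Fin N} (h : i ≠ j) (c : F) (f : MvPolynomial (Fin N) F) :
    divDiff i j (c • f) = c • divDiff i j f := by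
  apply divDiff_eq h
  rw [map_smul, mul_smul_comm, ← sub_rename_swap h, smul_sub]

theorem divDiff_mul {i j : Fin N} (h : i ≠ j) (f g : MvPolynomial (Fin N) F) :
    divDiff i j (f * g) =
      f * divDiff i j g + divDiff i j f * rename (Equiv.swap i j) g := by
  apply divDiff_eq h
  rw [map_mul]
  linear_combination f * sub_rename_swap h g + sub_rename_swap h f * rename (Equiv.swap i j) g

theorem divDiff_eq_zero {i j : Fin N} (h : i ≠ j) {f : MvPolynomial (Fin N) F}
    (hf : rename (Equiv.swap i j) f = f) : divDiff i j f = 0 := by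
  apply divDiff_eq h
  rw [hf, sub_self, mul_zero]

theorem divDiff_swap {i j : Fin N} (h : i ≠ j) (f : MvPolynomial (Fin N) F) :
    divDiff j i (rename (Equiv.swap i j) f) = divDiff i j f := by
  apply divDiff_eq h.symm
  have := sub_rename_swap h f
  rw [rename_rename, Equiv.swap_comm j i, ← Equiv.Perm.coe_mul, Equiv.swap_mul_self,
    Equiv.Perm.coe_one, rename_id_apply]
  linear_combination - this

theorem rename_comp_swap (σ : Equiv.Perm (Fin N)) (i j : Fin N) (f : MvPolynomial (Fin N) F) :
    rename σ (rename (Equiv.swap i j) f) = rename (Equiv.swap (σ i) (σ j)) (rename σ f) := by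
  simp only [rename_rename]
  congr 2
  funext k
  simp [Equiv.swap_apply_apply]

theorem rename_divDiff (σ : Equiv.Perm (Fin N)) {i j : Fin N} (h : i ≠ j)
    (f : MvPolynomial (Fin N) F) :
    rename σ (divDiff i j f) = divDiff (σ i) (σ j) (rename σ f) := by
  symm
  apply divDiff_eq (σ.injective.ne h)
  rw [← rename_comp_swap, ← map_sub, sub_rename_swap h, map_mul, map_sub, rename_X, rename_X]

end DividedDifference

section DunklOperator

variable {F : Type*} [Field F] {N : ℕ} (β : F)

theorem nabla_apply (i : Fin N) (f : MvPolynomial (Fin N) F) :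
    nabla β i f = pderiv i f + β • ∑ j ∈ univ.erase i, divDiff i j f := rfl

/-- The Dunkl operator as a linear map. -/
noncomputable def nablaEnd (i : Fin N) : Module.End F (MvPolynomial (Fin N) F) where
  toFun := nabla β i
  map_add' f g := by
    have : ∑ j ∈ univ.erase i, divDiff i j (f + g) =
        ∑ j ∈ univ.erase i, divDiff i j f + ∑ j ∈ univ.erase i, divDiff i j g := by
      rw [← sum_add_distrib]
      exact sum_congr rfl fun j hj => divDiff_add (ne_of_mem_erase hj).symm f g
    rw [nabla_apply, nabla_apply, nabla_apply, this, map_add, smul_add]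
    abel
  map_smul' c f := by
    have : ∑ j ∈ univ.erase i, divDiff i j (c • f) = c • ∑ j ∈ univ.erase i, divDiff i j f := by
      rw [smul_sum]
      exact sum_congr rfl fun j hj => divDiff_smul (ne_of_mem_erase hj).symm c f
    rw [nabla_apply, nabla_apply, this, Derivation.map_smul, smul_add, smul_comm, RingHom.id_apply]

/-- The operator `D_i = z_i ∇_i` as a linear map. -/
noncomputable def dopEnd (i : Fin N) : Module.End F (MvPolynomial (Fin N) F) :=
  LinearMap.mulLeft F (X i) * nablaEnd β i

/-- The permutation of the variables by `σ` as a linear map. -/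
noncomputable def permEnd (σ : Equiv.Perm (Fin N)) : Module.End F (MvPolynomial (Fin N) F) :=
  (rename σ).toLinearMap

/-- The exchange operator `K_{ij}` as a linear map. -/
noncomputable def swapEnd (i j : Fin N) : Module.End F (MvPolynomial (Fin N) F) :=
  permEnd (Equiv.swap i j)

theorem nablaEnd_apply (i : Fin N) (f : MvPolynomial (Fin N) F) :
    nablaEnd β i f = pderiv i f + β • ∑ j ∈ univ.erase i, divDiff i j f := rfl

theorem dopEnd_apply (i : Fin N) (f : MvPolynomial (Fin N) F) :
    dopEnd β i f = X i * nablaEnd β i f := rfl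

theorem permEnd_apply (σ : Equiv.Perm (Fin N)) (f : MvPolynomial (Fin N) F) :
    permEnd σ f = rename σ f := rfl

theorem swapEnd_apply (i j : Fin N) (f : MvPolynomial (Fin N) F) :
    swapEnd i j f = rename (Equiv.swap i j) f := rfl

theorem permEnd_mul_apply (σ : Equiv.Perm (Fin N)) (p f : MvPolynomial (Fin N) F) :
    permEnd σ (p * f) = permEnd σ p * permEnd σ f := map_mul (rename σ) p f

theorem swapEnd_comm (i j : Fin N) :
    (swapEnd i j : Module.End F (MvPolynomial (Fin N) F)) = swapEnd j i := by
  rw [swapEnd, swapEnd, Equiv.swap_comm]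

theorem permEnd_mul_swapEnd (σ : Equiv.Perm (Fin N)) (i j : Fin N) :
    permEnd σ * (swapEnd i j : Module.End F (MvPolynomial (Fin N) F)) =
      swapEnd (σ i) (σ j) * permEnd σ := by
  refine LinearMap.ext fun f => ?_
  exact rename_comp_swap σ i j f

theorem permEnd_nablaEnd (σ : Equiv.Perm (Fin N)) (i : Fin N) (f : MvPolynomial (Fin N) F) :
    permEnd σ (nablaEnd β i f) = nablaEnd β (σ i) (permEnd σ f) := by
  rw [nablaEnd_apply, nablaEnd_apply, map_add, map_smul, map_sum]
  simp only [permEnd_apply]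
  rw [pderiv_rename σ.injective]
  congr 2
  refine sum_bij (fun j _ => σ j) ?_ ?_ ?_ ?_
  · intro j hj
    exact mem_erase.2 ⟨σ.injective.ne (ne_of_mem_erase hj), mem_univ _⟩
  · intro a _ b _ h
    exact σ.injective h
  · intro b hb
    refine ⟨σ.symm b, mem_erase.2 ⟨?_, mem_univ _⟩, σ.apply_symm_apply b⟩
    rintro rfl
    simp at hb
  · intro j hj
    exact rename_divDiff σ (ne_of_mem_erase hj).symm f

theorem permEnd_mul_dopEnd (σ : Equiv.Perm (Fin N)) (i : Fin N) :
    permEnd σ * dopEnd β i = dopEnd β (σ i) * permEnd σ := by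
  refine LinearMap.ext fun f => ?_
  simp only [Module.End.mul_apply, dopEnd_apply, permEnd_mul_apply, permEnd_nablaEnd]
  simp [permEnd_apply]

theorem nablaEnd_mul (i : Fin N) (p f : MvPolynomial (Fin N) F) :
    nablaEnd β i (p * f) = p * nablaEnd β i f + pderiv i p * f
      + β • ∑ j ∈ univ.erase i, divDiff i j p * swapEnd i j f := by
  have : ∑ j ∈ univ.erase i, divDiff i j (p * f) = p * ∑ j ∈ univ.erase i, divDiff i j f
      + ∑ j ∈ univ.erase i, divDiff i j p * swapEnd i j f := by
    rw [mul_sum, ← sum_add_distrib]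
    exact sum_congr rfl fun j hj => divDiff_mul (ne_of_mem_erase hj).symm p f
  rw [nablaEnd_apply, nablaEnd_apply, this, pderiv_mul, smul_add, mul_add, mul_smul_comm]
  ring

theorem divDiff_X_left {i j : Fin N} (h : i ≠ j) :
    divDiff i j (X i : MvPolynomial (Fin N) F) = 1 := by
  apply divDiff_eq h
  simp

theorem divDiff_X_right {i j : Fin N} (h : i ≠ j) :
    divDiff i j (X j : MvPolynomial (Fin N) F) = -1 := by
  apply divDiff_eq h
  simp

theorem nablaEnd_X_mul_of_ne {i k : Fin N} (h : i ≠ k) (f : MvPolynomial (Fin N) F) :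
    nablaEnd β i (X k * f) = X k * nablaEnd β i f - β • swapEnd i k f := by
  rw [nablaEnd_mul, pderiv_X_of_ne h.symm, sum_eq_single_of_mem k (by simp [h.symm]),
    divDiff_X_right h]
  · simp [sub_eq_add_neg]
  · intro j hj hjk
    rw [divDiff_eq_zero (ne_of_mem_erase hj).symm, zero_mul]
    rw [rename_X, Equiv.swap_apply_of_ne_of_ne h.symm hjk.symm]

theorem nablaEnd_X_mul_self (i : Fin N) (f : MvPolynomial (Fin N) F) :
    nablaEnd β i (X i * f) =
      X i * nablaEnd β i f + f + β • ∑ j ∈ univ.erase i, swapEnd i j f := by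
  rw [nablaEnd_mul, pderiv_X_self, one_mul]
  congr 2
  exact sum_congr rfl fun j hj => by rw [divDiff_X_left (ne_of_mem_erase hj).symm, one_mul]

theorem nablaEnd_one (i : Fin N) : nablaEnd β i (1 : MvPolynomial (Fin N) F) = 0 := by
  rw [nablaEnd_apply, sum_eq_zero]
  · simp
  · intro j hj
    exact divDiff_eq_zero (ne_of_mem_erase hj).symm (map_one _)

end DunklOperator

section HeckeRelations

variable {F : Type*} [Field F] {N : ℕ} (β : F)

theorem nablaEnd_swapEnd (i j k : Fin N) (f : MvPolynomial (Fin N) F) :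
    nablaEnd β k (swapEnd i j f) = swapEnd i j (nablaEnd β (Equiv.swap i j k) f) := by
  rw [swapEnd, permEnd_nablaEnd, Equiv.swap_apply_self]

theorem nablaEnd_comm_X_mul {a b : Fin N} (hab : a ≠ b) {f : MvPolynomial (Fin N) F}
    (hf : nablaEnd β a (nablaEnd β b f) = nablaEnd β b (nablaEnd β a f)) :
    nablaEnd β a (nablaEnd β b (X a * f)) = nablaEnd β b (nablaEnd β a (X a * f)) := by
  have hb : b ∈ univ.erase a := by simp [hab.symm]
  have hsum : ∑ j ∈ univ.erase a, swapEnd a j (nablaEnd β b f) =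
      swapEnd a b (nablaEnd β b f) +
        (∑ j ∈ univ.erase a, nablaEnd β b (swapEnd a j f) - nablaEnd β b (swapEnd a b f)) := by
    rw [← add_sum_erase _ _ hb, ← add_sum_erase _ (fun j => nablaEnd β b (swapEnd a j f)) hb]
    rw [add_sub_cancel_left]
    congr 1
    refine sum_congr rfl fun j hj => ?_
    simp only [mem_erase] at hj
    rw [nablaEnd_swapEnd, Equiv.swap_apply_of_ne_of_ne hab.symm hj.1.symm]
  rw [nablaEnd_X_mul_of_ne β hab.symm, nablaEnd_X_mul_self, map_sub, nablaEnd_X_mul_self,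
    map_add, map_add, nablaEnd_X_mul_of_ne β hab.symm, hsum, map_smul, map_smul, map_sum, hf,
    swapEnd_comm b a, nablaEnd_swapEnd β a b a, nablaEnd_swapEnd β a b b, Equiv.swap_apply_left,
    Equiv.swap_apply_right]
  simp only [smul_add, smul_sub]
  abel

/-- The Dunkl operators commute. -/
theorem nablaEnd_comm (a b : Fin N) (f : MvPolynomial (Fin N) F) :
    nablaEnd β a (nablaEnd β b f) = nablaEnd β b (nablaEnd β a f) := by
  rcases eq_or_ne a b with rfl | hab
  · rfl
  induction f using MvPolynomial.induction_on with
  | C c =>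
    have : (C c : MvPolynomial (Fin N) F) = c • 1 := by rw [smul_eq_C_mul, mul_one]
    simp only [this, map_smul, nablaEnd_one, map_zero]
  | add p q hp hq => simp only [map_add, hp, hq]
  | mul_X p c hp =>
    rw [mul_comm p]
    rcases eq_or_ne a c with rfl | hac
    · exact nablaEnd_comm_X_mul β hab hp
    rcases eq_or_ne b c with rfl | hbc
    · exact (nablaEnd_comm_X_mul β hab.symm hp.symm).symm
    rw [nablaEnd_X_mul_of_ne β hbc, nablaEnd_X_mul_of_ne β hac, map_sub, map_sub,
      nablaEnd_X_mul_of_ne β hbc, nablaEnd_X_mul_of_ne β hac, map_smul, map_smul, hp,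
      nablaEnd_swapEnd, nablaEnd_swapEnd, Equiv.swap_apply_of_ne_of_ne hab hac,
      Equiv.swap_apply_of_ne_of_ne hab.symm hbc]
    abel

theorem dopEnd_mul_dopEnd {a b : Fin N} (hab : a ≠ b) :
    dopEnd β a * dopEnd β b = dopEnd β b * dopEnd β a
      + β • (dopEnd β b * swapEnd a b - dopEnd β a * swapEnd a b) := by
  refine LinearMap.ext fun f => ?_
  simp only [Module.End.mul_apply, LinearMap.add_apply, LinearMap.smul_apply, LinearMap.sub_apply,
    dopEnd_apply]
  rw [nablaEnd_X_mul_of_ne β hab, nablaEnd_X_mul_of_ne β hab.symm, nablaEnd_comm β a b,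
    swapEnd_comm b a, nablaEnd_swapEnd β a b a, nablaEnd_swapEnd β a b b, Equiv.swap_apply_left,
    Equiv.swap_apply_right]
  simp only [smul_eq_C_mul]
  ring

/-- The Cherednik operator `D_a + β ∑_{l ∈ S} K_{la}`, where `S` is the set of indices that
precede `a`. -/
noncomputable def cherednik (S : Finset (Fin N)) (a : Fin N) :
    Module.End F (MvPolynomial (Fin N) F) :=
  dopEnd β a + β • ∑ l ∈ S, swapEnd l a

theorem permEnd_mul_cherednik (σ : Equiv.Perm (Fin N)) (S : Finset (Fin N)) (a : Fin N) :
    permEnd σ * cherednik β S a = cherednik β (S.image σ) (σ a) * permEnd σ := by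
  rw [cherednik, cherednik, mul_add, add_mul, permEnd_mul_dopEnd, mul_smul_comm, smul_mul_assoc,
    mul_sum, sum_mul, sum_image σ.injective.injOn]
  simp only [permEnd_mul_swapEnd]

theorem image_swap_of_notMem {S : Finset (Fin N)} {a b : Fin N} (ha : a ∉ S) (hb : b ∉ S) :
    S.image (Equiv.swap a b) = S := by
  have : S.image (Equiv.swap a b) = S.image id := image_congr fun x hx =>
    Equiv.swap_apply_of_ne_of_ne (fun h => ha (h ▸ hx)) (fun h => hb (h ▸ hx))
  rw [this, image_id]

theorem swapEnd_mul_cherednik {S : Finset (Fin N)} {a b : Fin N} (ha : a ∉ S) (hb : b ∉ S)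
    (c : Fin N) : swapEnd a b * cherednik β S c = cherednik β S (Equiv.swap a b c) * swapEnd a b := by
  rw [swapEnd, permEnd_mul_cherednik, image_swap_of_notMem ha hb]

theorem swapEnd_mul_dopEnd (a b c : Fin N) :
    swapEnd a b * dopEnd β c = dopEnd β (Equiv.swap a b c) * swapEnd a b :=
  permEnd_mul_dopEnd β _ c

theorem commute_swapEnd_swapEnd {a b c d : Fin N} (hac : a ≠ c) (had : a ≠ d) (hbc : b ≠ c)
    (hbd : b ≠ d) :
    Commute (swapEnd a b : Module.End F (MvPolynomial (Fin N) F)) (swapEnd c d) := by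
  have := permEnd_mul_swapEnd (F := F) (Equiv.swap a b) c d
  rwa [Equiv.swap_apply_of_ne_of_ne hac.symm hbc.symm,
    Equiv.swap_apply_of_ne_of_ne had.symm hbd.symm] at this

theorem sum_swapEnd_mul_sum_swapEnd {S : Finset (Fin N)} {a b : Fin N} (hab : a ≠ b) (ha : a ∉ S)
    (hb : b ∉ S) :
    ((∑ l ∈ S, swapEnd l a) * ∑ l ∈ S, swapEnd l b : Module.End F (MvPolynomial (Fin N) F)) =
      (∑ l ∈ S, swapEnd l b) * ∑ l ∈ S, swapEnd l a
        + ((∑ l ∈ S, swapEnd l b) * swapEnd a b - (∑ l ∈ S, swapEnd l a) * swapEnd a b) := by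
  rw [sum_mul_sum, sum_mul_sum, sum_mul, sum_mul, ← sum_sub_distrib, sum_comm, ← sum_add_distrib]
  refine sum_congr rfl fun l hl => ?_
  rw [← add_sum_erase _ _ hl, ← add_sum_erase _ (fun m => swapEnd l b * swapEnd m a) hl]
  have hla : l ≠ a := fun h => ha (h ▸ hl)
  have hlb : l ≠ b := fun h => hb (h ▸ hl)
  have h1 := permEnd_mul_swapEnd (F := F) (Equiv.swap l b) a b
  have h2 := permEnd_mul_swapEnd (F := F) (Equiv.swap l a) a b
  rw [Equiv.swap_apply_of_ne_of_ne hla.symm hab, Equiv.swap_apply_right] at h1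
  rw [Equiv.swap_apply_of_ne_of_ne hlb.symm hab.symm, Equiv.swap_apply_right] at h2
  change swapEnd l b * swapEnd a b = swapEnd a l * swapEnd l b at h1
  change swapEnd l a * swapEnd a b = swapEnd l b * swapEnd l a at h2
  rw [h1, h2, swapEnd_comm a l]
  have : ∑ m ∈ S.erase l, (swapEnd m a * swapEnd l b : Module.End F (MvPolynomial (Fin N) F)) =
      ∑ m ∈ S.erase l, swapEnd l b * swapEnd m a := sum_congr rfl fun m hm =>
    commute_swapEnd_swapEnd (ne_of_mem_erase hm) (fun h => hb (h ▸ mem_of_mem_erase hm)) hla.symm hab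
  rw [this]
  abel

theorem cherednik_mul_cherednik {S : Finset (Fin N)} {a b : Fin N} (hab : a ≠ b) (ha : a ∉ S)
    (hb : b ∉ S) :
    cherednik β S a * cherednik β S b = cherednik β S b * cherednik β S a
      + β • (cherednik β S b * swapEnd a b - cherednik β S a * swapEnd a b) := by
  have h1 : dopEnd β a * (∑ l ∈ S, swapEnd l b) = (∑ l ∈ S, swapEnd l b) * dopEnd β a := by
    rw [mul_sum, sum_mul]
    refine sum_congr rfl fun l hl => ?_
    rw [swapEnd_mul_dopEnd, Equiv.swap_apply_of_ne_of_ne (ne_of_mem_of_not_mem hl ha).symm hab]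
  have h2 : dopEnd β b * (∑ l ∈ S, swapEnd l a) = (∑ l ∈ S, swapEnd l a) * dopEnd β b := by
    rw [mul_sum, sum_mul]
    refine sum_congr rfl fun l hl => ?_
    rw [swapEnd_mul_dopEnd, Equiv.swap_apply_of_ne_of_ne (ne_of_mem_of_not_mem hl hb).symm hab.symm]
  simp only [cherednik, mul_add, add_mul, smul_mul_assoc, mul_smul_comm, h1, h2,
    dopEnd_mul_dopEnd β hab, sum_swapEnd_mul_sum_swapEnd hab ha hb, smul_add, smul_sub]
  abel

theorem commute_cherednik {S T : Finset (Fin N)} {a b : Fin N} (ha : a ∉ S) (hb : b ∉ T)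
    (h : insert a S ⊆ T) : Commute (cherednik β S a) (cherednik β T b) := by
  have haT : a ∈ T := h (mem_insert_self _ _)
  have hbS : b ∉ S := fun hb' => hb (h (mem_insert_of_mem hb'))
  have hab : a ≠ b := fun hab => hb (hab ▸ haT)
  have hT : cherednik β T b = cherednik β S b + β • swapEnd a b
      + β • ∑ r ∈ T \ insert a S, swapEnd r b := by
    rw [cherednik, cherednik, ← sum_sdiff h, sum_insert ha, smul_add, smul_add]
    abel
  have hZ : Commute (cherednik β S a) (∑ r ∈ T \ insert a S, swapEnd r b) := by
    refine Commute.sum_right _ _ _ fun r hr => ?_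
    simp only [mem_sdiff, mem_insert, not_or] at hr
    have := swapEnd_mul_cherednik β hr.2.2 hbS a
    rw [Equiv.swap_apply_of_ne_of_ne (Ne.symm hr.2.1) hab] at this
    exact this.symm
  have hK := swapEnd_mul_cherednik β ha hbS a
  rw [Equiv.swap_apply_left] at hK
  rw [hT]
  refine Commute.add_right ?_ (hZ.smul_right β)
  rw [commute_iff_eq, mul_add, add_mul, cherednik_mul_cherednik β hab ha hbS, mul_smul_comm,
    smul_mul_assoc, hK, smul_sub]
  abel

end HeckeRelations

section CherednikProducts

variable {F : Type*} [Field F] {N : ℕ} (β : F)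

/-- The entries of `L` are distinct and do not belong to `S`. -/
def IsFresh (S : Finset (Fin N)) (L : List (Fin N)) : Prop :=
  L.Nodup ∧ ∀ x ∈ L, x ∉ S

theorem IsFresh.head {S : Finset (Fin N)} {a : Fin N} {L : List (Fin N)}
    (h : IsFresh S (a :: L)) : a ∉ S :=
  h.2 a List.mem_cons_self

theorem IsFresh.tail {S : Finset (Fin N)} {a : Fin N} {L : List (Fin N)}
    (h : IsFresh S (a :: L)) : IsFresh (insert a S) L := by
  obtain ⟨h1, h2⟩ := h
  rw [List.nodup_cons] at h1
  refine ⟨h1.2, fun x hx hxS => ?_⟩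
  rcases mem_insert.1 hxS with rfl | hxS
  · exact h1.1 hx
  · exact h2 x (List.mem_cons_of_mem _ hx) hxS

theorem IsFresh.perm {S : Finset (Fin N)} {L L' : List (Fin N)} (h : IsFresh S L)
    (hp : L.Perm L') : IsFresh S L' :=
  ⟨hp.nodup_iff.1 h.1, fun x hx => h.2 x (hp.mem_iff.2 hx)⟩

theorem IsFresh.of_append_left {S : Finset (Fin N)} {L L' : List (Fin N)}
    (h : IsFresh S (L ++ L')) : IsFresh S L :=
  ⟨h.1.of_append_left, fun x hx => h.2 x (List.mem_append_left _ hx)⟩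

theorem IsFresh.of_append_right {S : Finset (Fin N)} {L L' : List (Fin N)}
    (h : IsFresh S (L ++ L')) : IsFresh (S ∪ L.toFinset) L' := by
  refine ⟨h.1.of_append_right, fun x hx hxS => ?_⟩
  rcases mem_union.1 hxS with hxS | hxL
  · exact h.2 x (List.mem_append_right _ hx) hxS
  · exact (List.nodup_append.1 h.1).2.2 x (List.mem_toFinset.1 hxL) x hx rfl

theorem IsFresh.of_nodup {L : List (Fin N)} (h : L.Nodup) : IsFresh ∅ L :=
  ⟨h, fun x _ => notMem_empty x⟩

/-- The product of the Cherednik operators along `L`, when the indices in `S` precede `L`. -/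
noncomputable def cherProd :
    Finset (Fin N) → List (Fin N) → Module.End F (MvPolynomial (Fin N) F)
  | _, [] => 1
  | S, b :: L => cherednik β S b * cherProd (insert b S) L

/-- The sum of the `p`-th powers of the Cherednik operators along `L`, when the indices in `S`
precede `L`. -/
noncomputable def cherPowSum (p : ℕ) :
    Finset (Fin N) → List (Fin N) → Module.End F (MvPolynomial (Fin N) F)
  | _, [] => 0
  | S, b :: L => cherednik β S b ^ p + cherPowSum p (insert b S) L

theorem cherednik_insert {S : Finset (Fin N)} {a b : Fin N} (ha : a ∉ S) :
    cherednik β (insert a S) b = cherednik β S b + β • swapEnd a b := by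
  rw [cherednik, cherednik, sum_insert ha, smul_add]
  abel

theorem cherednik_exchange_mul {S : Finset (Fin N)} {a b : Fin N} (hab : a ≠ b) (ha : a ∉ S)
    (hb : b ∉ S) : cherednik β S b * cherednik β (insert b S) a =
      cherednik β S a * cherednik β (insert a S) b := by
  rw [cherednik_insert β hb, cherednik_insert β ha, mul_add, mul_add, mul_smul_comm,
    mul_smul_comm, cherednik_mul_cherednik β hab ha hb, swapEnd_comm b a, smul_sub]
  generalize β • (cherednik β S b * swapEnd a b) = x
  generalize β • (cherednik β S a * swapEnd a b) = y
  abel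

theorem cherednik_exchange_pow {p : ℕ} (hp : p = 1 ∨ p = 2) {S : Finset (Fin N)} {a b : Fin N}
    (ha : a ∉ S) (hb : b ∉ S) : cherednik β S b ^ p + cherednik β (insert b S) a ^ p =
      cherednik β S a ^ p + cherednik β (insert a S) b ^ p := by
  have hK := swapEnd_mul_cherednik β ha hb a
  have hK' := swapEnd_mul_cherednik β ha hb b
  rw [Equiv.swap_apply_left] at hK
  rw [Equiv.swap_apply_right] at hK'
  rw [cherednik_insert β hb, cherednik_insert β ha, swapEnd_comm b a]
  generalize cherednik β S a = x at *
  generalize cherednik β S b = y at *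
  generalize (swapEnd a b : Module.End F (MvPolynomial (Fin N) F)) = k at *
  rcases hp with rfl | rfl
  · rw [pow_one, pow_one, pow_one, pow_one]
    abel
  · simp only [pow_two, mul_add, add_mul, mul_smul_comm, smul_mul_assoc, smul_add, hK, hK']
    abel

theorem cherProd_perm {L L' : List (Fin N)} (hp : L.Perm L') :
    ∀ {S : Finset (Fin N)}, IsFresh S L → cherProd β S L = cherProd β S L' := by
  induction hp with
  | nil => intro S _; rfl
  | cons x _ ih =>
    intro S h
    rw [cherProd, cherProd, ih h.tail]
  | swap a b L =>
    intro S h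
    have ha : a ∉ insert b S := h.tail.head
    simp only [mem_insert, not_or] at ha
    rw [cherProd, cherProd, cherProd, cherProd, ← mul_assoc, ← mul_assoc, insert_comm,
      cherednik_exchange_mul β ha.1 ha.2 h.head]
  | trans h1 _ ih1 ih2 =>
    intro S h
    rw [ih1 h, ih2 (h.perm h1)]

theorem cherPowSum_perm {p : ℕ} (hp : p = 1 ∨ p = 2) {L L' : List (Fin N)} (hL : L.Perm L') :
    ∀ {S : Finset (Fin N)}, IsFresh S L → cherPowSum β p S L = cherPowSum β p S L' := by
  induction hL with
  | nil => intro S _; rfl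
  | cons x _ ih =>
    intro S h
    rw [cherPowSum, cherPowSum, ih h.tail]
  | swap a b L =>
    intro S h
    have ha : a ∉ insert b S := h.tail.head
    simp only [mem_insert, not_or] at ha
    rw [cherPowSum, cherPowSum, cherPowSum, cherPowSum, ← add_assoc, ← add_assoc, insert_comm,
      cherednik_exchange_pow β hp ha.2 h.head]
  | trans h1 _ ih1 ih2 =>
    intro S h
    rw [ih1 h, ih2 (h.perm h1)]

theorem cherProd_append (L L' : List (Fin N)) : ∀ S : Finset (Fin N),
    cherProd β S (L ++ L') = cherProd β S L * cherProd β (S ∪ L.toFinset) L' := by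
  induction L with
  | nil => intro S; simp [cherProd]
  | cons a L ih =>
    intro S
    rw [List.cons_append, cherProd, cherProd, ih, mul_assoc, List.toFinset_cons, union_insert,
      insert_union]

theorem cherPowSum_append (p : ℕ) (L L' : List (Fin N)) : ∀ S : Finset (Fin N),
    cherPowSum β p S (L ++ L') = cherPowSum β p S L + cherPowSum β p (S ∪ L.toFinset) L' := by
  induction L with
  | nil => intro S; simp [cherPowSum]
  | cons a L ih =>
    intro S
    rw [List.cons_append, cherPowSum, cherPowSum, ih, add_assoc, List.toFinset_cons, union_insert,
      insert_union]

theorem commute_cherednik_cherProd {S : Finset (Fin N)} {a : Fin N} (ha : a ∉ S)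
    {L : List (Fin N)} : ∀ {T : Finset (Fin N)}, insert a S ⊆ T → IsFresh T L →
      Commute (cherednik β S a) (cherProd β T L) := by
  induction L with
  | nil => intro T _ _; exact Commute.one_right _
  | cons b L ih =>
    intro T hT h
    exact (commute_cherednik β ha h.head hT).mul_right
      (ih (hT.trans (subset_insert _ _)) h.tail)

theorem commute_cherednik_cherPowSum (p : ℕ) {S : Finset (Fin N)} {a : Fin N} (ha : a ∉ S)
    {L : List (Fin N)} : ∀ {T : Finset (Fin N)}, insert a S ⊆ T → IsFresh T L →
      Commute (cherednik β S a) (cherPowSum β p T L) := by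
  induction L with
  | nil => intro T _ _; exact Commute.zero_right _
  | cons b L ih =>
    intro T hT h
    exact ((commute_cherednik β ha h.head hT).pow_right p).add_right
      (ih (hT.trans (subset_insert _ _)) h.tail)

theorem commute_cherProd_cherednik {T : Finset (Fin N)} {b : Fin N} (hb : b ∉ T)
    {L : List (Fin N)} : ∀ {S : Finset (Fin N)}, IsFresh S L → S ∪ L.toFinset ⊆ T →
      Commute (cherProd β S L) (cherednik β T b) := by
  induction L with
  | nil => intro S _ _; exact Commute.one_left _
  | cons a L ih =>
    intro S h hT
    rw [List.toFinset_cons, union_insert, ← insert_union] at hT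
    exact (commute_cherednik β h.head hb (subset_union_left.trans hT)).mul_left (ih h.tail hT)

theorem commute_cherProd_cherPowSum_of_subset (p : ℕ) {S : Finset (Fin N)} {L : List (Fin N)}
    (h : IsFresh S L) {L' : List (Fin N)} : ∀ {T : Finset (Fin N)}, IsFresh T L' →
      S ∪ L.toFinset ⊆ T → Commute (cherProd β S L) (cherPowSum β p T L') := by
  induction L' with
  | nil => intro T _ _; exact Commute.zero_right _
  | cons b L' ih =>
    intro T h' hT
    exact ((commute_cherProd_cherednik β h'.head h hT).pow_right p).add_right
      (ih h'.tail (hT.trans (subset_insert _ _)))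

theorem commute_cherProd_cherPowSum_self (p : ℕ) {L : List (Fin N)} :
    ∀ {S : Finset (Fin N)}, IsFresh S L → Commute (cherProd β S L) (cherPowSum β p S L) := by
  induction L with
  | nil => intro S _; exact Commute.one_left _
  | cons a L ih =>
    intro S h
    have h1 : Commute (cherednik β S a) (cherProd β (insert a S) L) :=
      commute_cherednik_cherProd β h.head Subset.rfl h.tail
    have h2 : Commute (cherednik β S a) (cherPowSum β p (insert a S) L) :=
      commute_cherednik_cherPowSum β p h.head Subset.rfl h.tail
    exact (((Commute.refl _).pow_right p).add_right h2).mul_left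
      ((h1.symm.pow_right p).add_right (ih h.tail))

/-- The power sums of all the Cherednik operators commute with the products of Cherednik
operators. -/
theorem commute_cherProd_cherPowSum {p : ℕ} (hp : p = 1 ∨ p = 2) {b : Fin N} {L M : List (Fin N)}
    (h : (b :: L).Nodup) (hM : M.Nodup) (hM' : ∀ x, x ∈ M) :
    Commute (cherProd β {b} L) (cherPowSum β p ∅ M) := by
  have hf := IsFresh.of_nodup h
  set R := M.filter (fun x => x ∉ b :: L) with hR
  have hnd : ((b :: L) ++ R).Nodup := by
    refine List.nodup_append.2 ⟨h, hM.filter _, ?_⟩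
    rintro x hx y hy rfl
    simp only [hR, List.mem_filter, decide_eq_true_eq] at hy
    exact hy.2 hx
  have hperm : M.Perm ((b :: L) ++ R) := by
    rw [List.perm_ext_iff_of_nodup hM hnd]
    intro x
    simp only [hM', true_iff, List.mem_append, hR, List.mem_filter, true_and, decide_eq_true_eq]
    exact em _
  rw [cherPowSum_perm β hp hperm (IsFresh.of_nodup hM), List.cons_append, cherPowSum,
    cherPowSum_append]
  have hbL := hf.tail
  rw [insert_empty_eq] at *
  refine Commute.add_right ?_ (Commute.add_right (commute_cherProd_cherPowSum_self β p hbL)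
    (commute_cherProd_cherPowSum_of_subset β p hbL ?_ Subset.rfl))
  · exact ((commute_cherednik_cherProd β (notMem_empty b) (by simp) hbL).symm).pow_right p
  · have := (IsFresh.of_nodup hnd).of_append_right
    rwa [List.toFinset_cons, empty_union, insert_eq] at this

theorem permEnd_mul_cherProd (σ : Equiv.Perm (Fin N)) (L : List (Fin N)) :
    ∀ S : Finset (Fin N), permEnd σ * cherProd β S L =
      cherProd β (S.image σ) (L.map σ) * permEnd σ := by
  induction L with
  | nil => intro S; simp [cherProd]
  | cons a L ih =>
    intro S
    rw [List.map_cons, cherProd, cherProd, ← mul_assoc, permEnd_mul_cherednik, mul_assoc, ih,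
      image_insert, mul_assoc]

end CherednikProducts

section SymmetricPolynomials

variable {F : Type*} [Field F] {N : ℕ} (β : F)

/-- A polynomial fixed by all permutations of the variables. -/
def IsPermInvariant (f : MvPolynomial (Fin N) F) : Prop :=
  ∀ σ : Equiv.Perm (Fin N), permEnd σ f = f

theorem image_swap_of_mem {S : Finset (Fin N)} {a b : Fin N} (ha : a ∈ S) (hb : b ∈ S) :
    S.image (Equiv.swap a b) = S := by
  refine eq_of_subset_of_card_le ?_ (card_image_of_injective _ (Equiv.injective _)).ge
  intro x hx
  obtain ⟨y, hy, rfl⟩ := mem_image.1 hx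
  rcases eq_or_ne y a with rfl | hya
  · rwa [Equiv.swap_apply_left]
  rcases eq_or_ne y b with rfl | hyb
  · rwa [Equiv.swap_apply_right]
  rwa [Equiv.swap_apply_of_ne_of_ne hya hyb]

theorem permEnd_cherProd_apply {f : MvPolynomial (Fin N) F} (hf : IsPermInvariant f)
    (σ : Equiv.Perm (Fin N)) (S : Finset (Fin N)) (L : List (Fin N)) :
    permEnd σ (cherProd β S L f) = cherProd β (S.image σ) (L.map σ) f := by
  rw [← Module.End.mul_apply, permEnd_mul_cherProd, Module.End.mul_apply, hf σ]

theorem Dlist_eq_cherProd {f : MvPolynomial (Fin N) F} (hf : IsPermInvariant f)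
    {L : List (Fin N)} : ∀ {S : Finset (Fin N)} {k : ℕ}, IsFresh S L → S.card = k →
      Dlist β k L f = cherProd β S L f := by
  induction L with
  | nil => intro S k _ _; rfl
  | cons b L ih =>
    intro S k h hk
    rw [Dlist, ih h.tail (by rw [card_insert_of_notMem h.head, hk]), cherProd, Module.End.mul_apply,
      cherednik, LinearMap.add_apply, LinearMap.smul_apply, LinearMap.sum_apply, mul_comm, mul_smul]
    congr 2
    rw [← hk, Nat.cast_smul_eq_nsmul, ← sum_const]
    refine sum_congr rfl fun l hl => ?_
    have hL : L.map (Equiv.swap l b) = L.map id := List.map_congr_left fun x hx => by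
      have hx' := h.tail.2 x hx
      simp only [mem_insert, not_or] at hx'
      exact Equiv.swap_apply_of_ne_of_ne (ne_of_mem_of_not_mem hl hx'.2).symm hx'.1
    rw [swapEnd, permEnd_cherProd_apply β hf, hL, List.map_id,
      image_swap_of_mem (mem_insert_of_mem hl) (mem_insert_self _ _)]

theorem swapEnd_dopEnd_apply {f : MvPolynomial (Fin N) F} (hf : IsPermInvariant f) (l a : Fin N) :
    swapEnd l a (dopEnd β a f) = dopEnd β l f := by
  rw [← Module.End.mul_apply, swapEnd_mul_dopEnd, Module.End.mul_apply, Equiv.swap_apply_right,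
    swapEnd, hf]

theorem cherednik_apply {f : MvPolynomial (Fin N) F} (hf : IsPermInvariant f)
    (S : Finset (Fin N)) (a : Fin N) :
    cherednik β S a f = dopEnd β a f + (β * (S.card : F)) • f := by
  simp only [cherednik, LinearMap.add_apply, LinearMap.smul_apply, LinearMap.sum_apply, swapEnd,
    hf _, sum_const, mul_smul, Nat.cast_smul_eq_nsmul]

theorem cherednik_cherednik_apply {f : MvPolynomial (Fin N) F} (hf : IsPermInvariant f)
    (S : Finset (Fin N)) (a : Fin N) :
    cherednik β S a (cherednik β S a f) = dopEnd β a (dopEnd β a f)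
      + β • (((S.card : F)) • dopEnd β a f + ∑ l ∈ S, dopEnd β l f)
      + (β * (S.card : F)) ^ 2 • f := by
  rw [cherednik_apply β hf, map_add, map_smul, cherednik_apply β hf, cherednik,
    LinearMap.add_apply, LinearMap.smul_apply, LinearMap.sum_apply]
  simp only [swapEnd_dopEnd_apply β hf]
  module

theorem cherPowSum_one_apply {f : MvPolynomial (Fin N) F} (hf : IsPermInvariant f)
    {L : List (Fin N)} : ∀ {S : Finset (Fin N)}, IsFresh S L →
      cherPowSum β 1 S L f = (L.map fun a => dopEnd β a f).sum
        + (β * ∑ t ∈ range L.length, ((S.card + t : ℕ) : F)) • f := by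
  induction L with
  | nil => intro S _; simp [cherPowSum]
  | cons a L ih =>
    intro S h
    rw [cherPowSum, LinearMap.add_apply, pow_one, ih h.tail, cherednik_apply β hf, List.map_cons,
      List.sum_cons, List.length_cons, sum_range_succ', card_insert_of_notMem h.head]
    simp only [add_zero, add_assoc, add_comm 1]
    module

theorem cherPowSum_two_apply {f : MvPolynomial (Fin N) F} (hf : IsPermInvariant f)
    {L : List (Fin N)} : ∀ {S : Finset (Fin N)}, IsFresh S L →
      cherPowSum β 2 S L f = (L.map fun a => dopEnd β a (dopEnd β a f)).sum
        + (β * ((S.card : F) + L.length - 1)) • (L.map fun a => dopEnd β a f).sum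
        + (β * L.length) • ∑ l ∈ S, dopEnd β l f
        + (∑ t ∈ range L.length, (β * ((S.card + t : ℕ) : F)) ^ 2) • f := by
  induction L with
  | nil => intro S _; simp [cherPowSum]
  | cons a L ih =>
    intro S h
    rw [cherPowSum, LinearMap.add_apply, pow_two, ih h.tail, Module.End.mul_apply,
      cherednik_cherednik_apply β hf, List.map_cons, List.sum_cons, List.map_cons, List.sum_cons,
      List.length_cons, sum_range_succ', card_insert_of_notMem h.head, sum_insert h.head]
    simp only [add_zero, add_assoc, add_comm 1]
    push_cast
    module

theorem pderiv_zJ_of_notMem {b : Fin N} {J : Finset (Fin N)} (hb : b ∉ J) :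
    pderiv b (zJ J : MvPolynomial (Fin N) F) = 0 := by
  induction J using Finset.induction_on with
  | empty => simp [zJ]
  | insert a J ha ih =>
    simp only [mem_insert, not_or] at hb
    have : (zJ (insert a J) : MvPolynomial (Fin N) F) = X a * zJ J := prod_insert ha
    rw [this, pderiv_mul, ih hb.2, pderiv_X_of_ne (Ne.symm hb.1)]
    simp

theorem X_mul_zJ_erase {a : Fin N} {J : Finset (Fin N)} (ha : a ∈ J) :
    X a * zJ (J.erase a) = (zJ J : MvPolynomial (Fin N) F) :=
  mul_prod_erase J _ ha

theorem permEnd_zJ (σ : Equiv.Perm (Fin N)) (J : Finset (Fin N)) :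
    permEnd σ (zJ J : MvPolynomial (Fin N) F) = zJ (J.image σ) := by
  rw [permEnd_apply, zJ, zJ, map_prod, prod_image σ.injective.injOn]
  simp only [rename_X]

theorem permEnd_swap_zJ_of_mem_notMem {a k : Fin N} {J : Finset (Fin N)} (ha : a ∈ J)
    (hk : k ∉ J) :
    permEnd (Equiv.swap a k) (zJ J : MvPolynomial (Fin N) F) = X k * zJ (J.erase a) := by
  rw [← X_mul_zJ_erase ha, permEnd_mul_apply, permEnd_zJ,
    image_swap_of_notMem (notMem_erase a J) (fun h => hk (mem_of_mem_erase h)), permEnd_apply,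
    rename_X, Equiv.swap_apply_left]

theorem dopEnd_zJ_mul_of_mem {a : Fin N} {J : Finset (Fin N)} (ha : a ∈ J)
    (g : MvPolynomial (Fin N) F) :
    dopEnd β a (zJ J * g) = zJ J * (dopEnd β a g + g + β • ∑ k ∈ Jᶜ, swapEnd k a g) := by
  have hsub : Jᶜ ⊆ univ.erase a := fun k hk =>
    mem_erase.2 ⟨fun h => mem_compl.1 hk (h ▸ ha), mem_univ k⟩
  have h1 : ∑ k ∈ univ.erase a, divDiff a k (zJ J) * swapEnd a k g =
      zJ (J.erase a) * ∑ k ∈ Jᶜ, swapEnd k a g := by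
    rw [← sum_subset hsub, mul_sum]
    · refine sum_congr rfl fun k hk => ?_
      rw [mem_compl] at hk
      rw [swapEnd_comm k a, divDiff_eq (ne_of_mem_of_not_mem ha hk)]
      have := permEnd_swap_zJ_of_mem_notMem (F := F) ha hk
      rw [permEnd_apply] at this
      rw [this, ← X_mul_zJ_erase ha, sub_mul]
    · intro k hk hkJ
      rw [mem_compl, not_not] at hkJ
      rw [divDiff_eq_zero (ne_of_mem_erase hk).symm, zero_mul]
      have := permEnd_zJ (F := F) (Equiv.swap a k) J
      rwa [image_swap_of_mem ha hkJ] at this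
  have h2 : pderiv a (zJ J : MvPolynomial (Fin N) F) = zJ (J.erase a) := by
    rw [← X_mul_zJ_erase ha, pderiv_mul, pderiv_X_self, pderiv_zJ_of_notMem (notMem_erase a J)]
    simp
  rw [dopEnd_apply, nablaEnd_mul, h1, h2, dopEnd_apply, ← X_mul_zJ_erase ha]
  simp only [smul_eq_C_mul]
  ring

theorem dopEnd_zJ_mul_of_notMem {b : Fin N} {J : Finset (Fin N)} (hb : b ∉ J)
    (g : MvPolynomial (Fin N) F) :
    dopEnd β b (zJ J * g) = zJ J * dopEnd β b g - β • ∑ c ∈ J, swapEnd c b (zJ J * g) := by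
  have hsub : J ⊆ univ.erase b := fun k hk =>
    mem_erase.2 ⟨fun h => hb (h ▸ hk), mem_univ k⟩
  have h1 : X b * ∑ k ∈ univ.erase b, divDiff b k (zJ J) * swapEnd b k g =
      - ∑ c ∈ J, swapEnd c b (zJ J * g) := by
    rw [← sum_subset hsub, mul_sum, ← sum_neg_distrib]
    · refine sum_congr rfl fun k hk => ?_
      have hkb := ne_of_mem_of_not_mem hk hb
      have h := permEnd_swap_zJ_of_mem_notMem (F := F) hk hb
      have h' := h
      rw [permEnd_apply, Equiv.swap_comm] at h'
      rw [divDiff_eq hkb.symm (c := - zJ (J.erase k))]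
      · rw [swapEnd, swapEnd, permEnd_mul_apply, h, Equiv.swap_comm b k]
        ring
      · rw [h', ← X_mul_zJ_erase hk]
        ring
    · intro k hk hkJ
      rw [divDiff_eq_zero (ne_of_mem_erase hk).symm, zero_mul]
      have := permEnd_zJ (F := F) (Equiv.swap b k) J
      rwa [image_swap_of_notMem hb hkJ] at this
  rw [dopEnd_apply, nablaEnd_mul, pderiv_zJ_of_notMem hb, mul_add, mul_smul_comm, h1, dopEnd_apply,
    smul_neg]
  ring

end SymmetricPolynomials

section CreationOperators

variable {F : Type*} [Field F] {N : ℕ} (β : F)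

/-- The polynomial is annihilated by all products of `m` Cherednik operators; on symmetric
polynomials, this is the vanishing of all `D_{0,J}` with `|J| = m`. -/
def IsNull (m : ℕ) (f : MvPolynomial (Fin N) F) : Prop :=
  ∀ L : List (Fin N), L.Nodup → L.length = m → cherProd β ∅ L f = 0

theorem IsNull.succ {m : ℕ} {f : MvPolynomial (Fin N) F} (h : IsNull β m f) :
    IsNull β (m + 1) f := by
  intro L hL hlen
  rcases L.eq_nil_or_concat with rfl | ⟨L', x, rfl⟩
  · simp at hlen
  rw [List.concat_eq_append] at *
  have hf := IsFresh.of_nodup hL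
  rw [cherProd_append, cherProd, cherProd, mul_one,
    (commute_cherProd_cherednik β (hf.of_append_right.2 x (by simp)) hf.of_append_left
      Subset.rfl).eq, Module.End.mul_apply, h L' hL.of_append_left (by simpa using hlen), map_zero]

theorem isFresh_sort {b : Fin N} {J : Finset (Fin N)} (hb : b ∉ J) :
    IsFresh {b} (J.sort (· ≤ ·)) :=
  ⟨sort_nodup J _, fun _ hx hxb => hb (mem_singleton.1 hxb ▸ (mem_sort _).1 hx)⟩

theorem DJ_eq_cherProd {f : MvPolynomial (Fin N) F} (hf : IsPermInvariant f) {b : Fin N}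
    {J : Finset (Fin N)} (hb : b ∉ J) :
    DJ β 1 J f = cherProd β {b} (J.sort (· ≤ ·)) f :=
  Dlist_eq_cherProd β hf (isFresh_sort hb) (card_singleton b)

theorem exists_notMem_of_card_lt {J : Finset (Fin N)} (hJ : J.card < N) : ∃ b, b ∉ J := by
  by_contra! h
  rw [eq_univ_of_forall h, card_univ, Fintype.card_fin] at hJ
  exact lt_irrefl _ hJ

theorem permEnd_DJ {f : MvPolynomial (Fin N) F} (hf : IsPermInvariant f)
    (σ : Equiv.Perm (Fin N)) {J : Finset (Fin N)} (hJ : J.card < N) :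
    permEnd σ (DJ β 1 J f) = DJ β 1 (J.image σ) f := by
  obtain ⟨b, hb⟩ := exists_notMem_of_card_lt hJ
  have hb' : σ b ∉ J.image σ := fun h => hb (by simpa using h)
  rw [DJ_eq_cherProd β hf hb, DJ_eq_cherProd β hf hb', permEnd_cherProd_apply β hf,
    image_singleton]
  refine (DFunLike.congr_fun (cherProd_perm β ?_ (isFresh_sort hb')) f).symm
  rw [List.perm_ext_iff_of_nodup (sort_nodup _ _) ((sort_nodup _ _).map σ.injective)]
  intro x
  simp

/-- The summand `z_J D_{1,J} f` of `B⁺_i f`. -/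
noncomputable def creationTerm (J : Finset (Fin N)) (f : MvPolynomial (Fin N) F) :
    MvPolynomial (Fin N) F :=
  zJ J * DJ β 1 J f

theorem Bplus_eq_sum (i : ℕ) (f : MvPolynomial (Fin N) F) :
    Bplus β i univ f = ∑ J ∈ univ.powersetCard i, creationTerm β J f := rfl

theorem permEnd_creationTerm {f : MvPolynomial (Fin N) F} (hf : IsPermInvariant f)
    (σ : Equiv.Perm (Fin N)) {J : Finset (Fin N)} (hJ : J.card < N) :
    permEnd σ (creationTerm β J f) = creationTerm β (J.image σ) f := by
  rw [creationTerm, permEnd_mul_apply, permEnd_zJ, permEnd_DJ β hf σ hJ, creationTerm]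

theorem IsPermInvariant.Bplus {f : MvPolynomial (Fin N) F} (hf : IsPermInvariant f) {i : ℕ}
    (hi : i < N) : IsPermInvariant (Bplus β i univ f) := by
  intro σ
  rw [Bplus_eq_sum, map_sum]
  refine sum_bij (fun J _ => J.image σ) ?_ ?_ ?_ ?_
  · intro J hJ
    rw [mem_powersetCard_univ] at *
    rw [card_image_of_injective _ σ.injective, hJ]
  · intro J _ J' _ h
    exact image_injective σ.injective h
  · intro J hJ
    rw [mem_powersetCard_univ] at hJ
    refine ⟨J.image σ.symm, ?_, ?_⟩
    · rw [mem_powersetCard_univ, card_image_of_injective _ σ.symm.injective, hJ]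
    · rw [image_image]
      simp
  · intro J hJ
    rw [mem_powersetCard_univ] at hJ
    exact permEnd_creationTerm β hf σ (hJ ▸ hi)

theorem dopEnd_DJ_eq_zero {f : MvPolynomial (Fin N) F} (hf : IsPermInvariant f)
    {J : Finset (Fin N)} (h0 : IsNull β (J.card + 1) f) {b : Fin N} (hb : b ∉ J) :
    dopEnd β b (DJ β 1 J f) = 0 := by
  have h := h0 (b :: J.sort (· ≤ ·)) (List.nodup_cons.2 ⟨by simpa using hb, sort_nodup _ _⟩)
    (by simp)
  rwa [cherProd, cherednik, sum_empty, smul_zero, add_zero, insert_empty_eq, Module.End.mul_apply,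
    ← DJ_eq_cherProd β hf hb] at h

theorem cherednik_creationTerm {f : MvPolynomial (Fin N) F} (hf : IsPermInvariant f)
    {J : Finset (Fin N)} (h0 : IsNull β (J.card + 1) f) (hJ : J.card < N) {A : Finset (Fin N)}
    (hA : A ⊆ J) {b : Fin N} (hb : b ∉ J) :
    cherednik β A b (creationTerm β J f) =
      - β • ∑ c ∈ J \ A, creationTerm β (J.image (Equiv.swap c b)) f := by
  have : ∑ c ∈ J \ A, creationTerm β (J.image (Equiv.swap c b)) f =
      ∑ c ∈ J \ A, swapEnd c b (creationTerm β J f) :=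
    sum_congr rfl fun c _ => (permEnd_creationTerm β hf _ hJ).symm
  rw [this, cherednik, LinearMap.add_apply, LinearMap.smul_apply, LinearMap.sum_apply]
  nth_rewrite 1 [creationTerm]
  rw [dopEnd_zJ_mul_of_notMem β hb, dopEnd_DJ_eq_zero β hf h0 hb, ← sum_sdiff hA]
  change zJ J * 0 - β • (∑ c ∈ J \ A, swapEnd c b (creationTerm β J f)
    + ∑ c ∈ A, swapEnd c b (creationTerm β J f)) + _ = _
  rw [mul_zero]
  module

theorem cherProd_creationTerm {f : MvPolynomial (Fin N) F} (hf : IsPermInvariant f) {i : ℕ}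
    (hi : i < N) (h0 : IsNull β (i + 1) f) (L : List (Fin N)) :
    ∀ {A J : Finset (Fin N)}, J.card = i → A ⊆ J → IsFresh J L → (J \ A).card < L.length →
      cherProd β A L (creationTerm β J f) = 0 := by
  induction L with
  | nil => intro A J _ _ _ h; simp at h
  | cons b L ih =>
    intro A J hJ hA hL hcard
    have hb := hL.head
    have hbA : b ∉ A := fun h => hb (hA h)
    have hfA : IsFresh A (b :: L) := ⟨hL.1, fun x hx h => hL.2 x hx (hA h)⟩
    rw [cherProd, (commute_cherednik_cherProd β hbA Subset.rfl hfA.tail).eq, Module.End.mul_apply,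
      cherednik_creationTerm β hf (hJ ▸ h0) (hJ ▸ hi) hA hb, map_smul, map_sum, sum_eq_zero,
      smul_zero]
    intro c hc
    rw [mem_sdiff] at hc
    have hmem : b ∈ J.image (Equiv.swap c b) := mem_image.2 ⟨c, hc.1, Equiv.swap_apply_left c b⟩
    have hJ' : (J.image (Equiv.swap c b)).card = i := by
      rw [card_image_of_injective _ (Equiv.injective _), hJ]
    have hA' : insert b A ⊆ J.image (Equiv.swap c b) := by
      refine insert_subset hmem fun a ha => mem_image.2 ⟨a, hA ha, ?_⟩
      exact Equiv.swap_apply_of_ne_of_ne (ne_of_mem_of_not_mem ha hc.2)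
        (ne_of_mem_of_not_mem ha hbA)
    refine ih hJ' hA' ⟨hL.tail.1, fun x hx hxJ => ?_⟩ ?_
    · have hx' := hL.tail.2 x hx
      simp only [mem_insert, not_or] at hx'
      obtain ⟨y, hy, hyx⟩ := mem_image.1 hxJ
      rw [← Equiv.apply_eq_iff_eq (Equiv.swap c b), Equiv.swap_apply_self,
        Equiv.swap_apply_of_ne_of_ne (ne_of_mem_of_not_mem hc.1 hx'.2).symm hx'.1] at hyx
      exact hx'.2 (hyx ▸ hy)
    · rw [card_sdiff_of_subset hA', card_insert_of_notMem hbA, hJ']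
      rw [card_sdiff_of_subset hA, List.length_cons, hJ] at hcard
      have : 0 < (J \ A).card := card_pos.2 ⟨c, mem_sdiff.2 hc⟩
      rw [card_sdiff_of_subset hA, hJ] at this
      omega

theorem IsNull.Bplus {f : MvPolynomial (Fin N) F} (hf : IsPermInvariant f) {i : ℕ}
    (hi : i < N) (h0 : IsNull β (i + 1) f) : IsNull β (i + 1) (Bplus β i univ f) := by
  intro M hM hlen
  rw [Bplus_eq_sum, map_sum]
  refine sum_eq_zero fun J hJ => ?_
  rw [mem_powersetCard_univ] at hJ
  have hperm : M.Perm (M.filter (· ∈ J) ++ M.filter (fun x => !decide (x ∈ J))) :=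
    (List.filter_append_perm _ M).symm
  have hsub : (M.filter (· ∈ J)).toFinset ⊆ J := fun x hx => by
    simp only [List.mem_toFinset, List.mem_filter, decide_eq_true_eq] at hx
    exact hx.2
  rw [cherProd_perm β hperm (IsFresh.of_nodup hM), cherProd_append, Module.End.mul_apply,
    empty_union, cherProd_creationTerm β hf hi h0 _ hJ hsub, map_zero]
  · refine ⟨hM.filter _, fun x hx => ?_⟩
    simp only [List.mem_filter, Bool.not_eq_true', decide_eq_false_iff_not] at hx
    exact hx.2
  · have h1 := hperm.length_eq
    have h2 := card_le_card hsub
    rw [List.length_append] at h1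
    rw [card_sdiff_of_subset hsub, List.toFinset_card_of_nodup (hM.filter _)] at *
    omega

end CreationOperators

section Commutators

variable {F : Type*} [Field F] {N : ℕ} (β : F)

theorem swapEnd_zJ_mul_of_mem {J : Finset (Fin N)} {l a : Fin N} (hl : l ∈ J) (ha : a ∈ J)
    (g : MvPolynomial (Fin N) F) : swapEnd l a (zJ J * g) = zJ J * swapEnd l a g := by
  rw [swapEnd, permEnd_mul_apply, permEnd_zJ, image_swap_of_mem hl ha]

theorem swapEnd_zJ_mul_of_notMem {J : Finset (Fin N)} {l a : Fin N} (hl : l ∉ J) (ha : a ∉ J)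
    (g : MvPolynomial (Fin N) F) : swapEnd l a (zJ J * g) = zJ J * swapEnd l a g := by
  rw [swapEnd, permEnd_mul_apply, permEnd_zJ, image_swap_of_notMem hl ha]

theorem cherednik_zJ_mul_of_mem {J S : Finset (Fin N)} (hS : S ⊆ J) {a : Fin N} (ha : a ∈ J)
    (g : MvPolynomial (Fin N) F) :
    cherednik β S a (zJ J * g) = zJ J * (cherednik β (Jᶜ ∪ S) a g + g) := by
  have hd : Disjoint Jᶜ S := disjoint_compl_left.mono_right hS
  have h : ∑ l ∈ S, swapEnd l a (zJ J * g) = zJ J * ∑ l ∈ S, swapEnd l a g := by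
    rw [mul_sum]
    exact sum_congr rfl fun l hl => swapEnd_zJ_mul_of_mem (hS hl) ha g
  simp only [cherednik, LinearMap.add_apply, LinearMap.smul_apply, LinearMap.sum_apply]
  rw [dopEnd_zJ_mul_of_mem β ha, h, sum_union hd]
  simp only [smul_eq_C_mul]
  ring

theorem cherednik_zJ_mul_of_notMem {J S : Finset (Fin N)} (hS : Disjoint J S) {c : Fin N}
    (hc : c ∉ J) (g : MvPolynomial (Fin N) F) :
    cherednik β (J ∪ S) c (zJ J * g) = zJ J * cherednik β S c g := by
  have h : ∑ l ∈ S, swapEnd l c (zJ J * g) = zJ J * ∑ l ∈ S, swapEnd l c g := by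
    rw [mul_sum]
    exact sum_congr rfl fun l hl =>
      swapEnd_zJ_mul_of_notMem (fun hlJ => disjoint_left.1 hS hlJ hl) hc g
  simp only [cherednik, LinearMap.add_apply, LinearMap.smul_apply, LinearMap.sum_apply]
  rw [dopEnd_zJ_mul_of_notMem β hc, sum_union hS, h]
  simp only [smul_eq_C_mul]
  ring

theorem cherPowSum_zJ_mul_of_notMem {p : ℕ} (hp : p = 1 ∨ p = 2) {J : Finset (Fin N)}
    (g : MvPolynomial (Fin N) F) (L : List (Fin N)) : ∀ {S : Finset (Fin N)}, Disjoint J S →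
      (∀ x ∈ L, x ∉ J) →
      cherPowSum β p (J ∪ S) L (zJ J * g) = zJ J * cherPowSum β p S L g := by
  induction L with
  | nil => intro S _ _; simp [cherPowSum]
  | cons c L ih =>
    intro S hS hL
    have hc := hL c List.mem_cons_self
    have hd : Disjoint J (insert c S) := disjoint_insert_right.2 ⟨hc, hS⟩
    rw [cherPowSum, cherPowSum, LinearMap.add_apply, LinearMap.add_apply, ← union_insert,
      ih hd fun x hx => hL x (List.mem_cons_of_mem _ hx), mul_add]
    congr 1
    rcases hp with rfl | rfl
    · rw [pow_one, pow_one, cherednik_zJ_mul_of_notMem β hS hc]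
    · rw [pow_two, pow_two, Module.End.mul_apply, Module.End.mul_apply,
        cherednik_zJ_mul_of_notMem β hS hc, cherednik_zJ_mul_of_notMem β hS hc]

theorem cherPowSum_one_zJ_mul_of_mem {J : Finset (Fin N)} (g : MvPolynomial (Fin N) F)
    (L : List (Fin N)) : ∀ {S : Finset (Fin N)}, S ⊆ J → (∀ x ∈ L, x ∈ J) →
      cherPowSum β 1 S L (zJ J * g) =
        zJ J * (cherPowSum β 1 (Jᶜ ∪ S) L g + (L.length : F) • g) := by
  induction L with
  | nil => intro S _ _; simp [cherPowSum]
  | cons a L ih =>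
    intro S hS hL
    have ha := hL a List.mem_cons_self
    rw [cherPowSum, cherPowSum, LinearMap.add_apply, LinearMap.add_apply, ← union_insert,
      ih (insert_subset ha hS) fun x hx => hL x (List.mem_cons_of_mem _ hx), pow_one, pow_one,
      cherednik_zJ_mul_of_mem β hS ha, ← mul_add, List.length_cons]
    push_cast
    congr 1
    module

theorem cherPowSum_two_zJ_mul_of_mem {J : Finset (Fin N)} (g : MvPolynomial (Fin N) F)
    (L : List (Fin N)) : ∀ {S : Finset (Fin N)}, S ⊆ J → (∀ x ∈ L, x ∈ J) →
      cherPowSum β 2 S L (zJ J * g) =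
        zJ J * (cherPowSum β 2 (Jᶜ ∪ S) L g + (2 : F) • cherPowSum β 1 (Jᶜ ∪ S) L g
          + (L.length : F) • g) := by
  induction L with
  | nil => intro S _ _; simp [cherPowSum]
  | cons a L ih =>
    intro S hS hL
    have ha := hL a List.mem_cons_self
    rw [cherPowSum, cherPowSum, cherPowSum, LinearMap.add_apply, LinearMap.add_apply,
      LinearMap.add_apply, ← union_insert,
      ih (insert_subset ha hS) fun x hx => hL x (List.mem_cons_of_mem _ hx), pow_one, pow_two,
      pow_two, Module.End.mul_apply, Module.End.mul_apply, cherednik_zJ_mul_of_mem β hS ha,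
      cherednik_zJ_mul_of_mem β hS ha, ← mul_add, List.length_cons, map_add]
    push_cast
    congr 1
    module

theorem univ_toList_perm (J : Finset (Fin N)) :
    (univ : Finset (Fin N)).toList.Perm (J.toList ++ Jᶜ.toList) := by
  have h : (J.toList ++ Jᶜ.toList).Nodup := by
    refine List.nodup_append.2 ⟨nodup_toList _, nodup_toList _, ?_⟩
    rintro x hx y hy rfl
    rw [mem_toList] at hx hy
    exact mem_compl.1 hy hx
  rw [List.perm_ext_iff_of_nodup (nodup_toList _) h]
  intro x
  simp only [mem_toList, mem_univ, true_iff, List.mem_append, mem_compl]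
  exact em _

theorem cherPowSum_univ {p : ℕ} (hp : p = 1 ∨ p = 2) (J : Finset (Fin N)) :
    cherPowSum β p ∅ univ.toList = cherPowSum β p ∅ J.toList + cherPowSum β p J Jᶜ.toList := by
  rw [cherPowSum_perm β hp (univ_toList_perm J) (IsFresh.of_nodup (nodup_toList _)),
    cherPowSum_append, empty_union, toList_toFinset]

theorem cherPowSum_one_zJ_mul (J : Finset (Fin N)) (g : MvPolynomial (Fin N) F) :
    cherPowSum β 1 ∅ univ.toList (zJ J * g) =
      zJ J * (cherPowSum β 1 ∅ univ.toList g + (J.card : F) • g) := by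
  have h := cherPowSum_zJ_mul_of_notMem β (Or.inl rfl) g Jᶜ.toList (disjoint_empty_right J)
    fun x hx => by simpa using hx
  have h' := cherPowSum_univ β (Or.inl rfl) Jᶜ
  rw [compl_compl] at h'
  rw [union_empty] at h
  conv_lhs => rw [cherPowSum_univ β (Or.inl rfl) J, LinearMap.add_apply, h,
    cherPowSum_one_zJ_mul_of_mem β g J.toList (empty_subset J) fun x hx => by simpa using hx,
    union_empty, ← mul_add, length_toList]
  rw [h', LinearMap.add_apply]
  congr 1
  abel

theorem cherPowSum_two_zJ_mul (J : Finset (Fin N)) (g : MvPolynomial (Fin N) F) :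
    cherPowSum β 2 ∅ univ.toList (zJ J * g) =
      zJ J * (cherPowSum β 2 ∅ univ.toList g
        + (2 : F) • (cherPowSum β 1 ∅ univ.toList g - cherPowSum β 1 ∅ Jᶜ.toList g)
        + (J.card : F) • g) := by
  have h := cherPowSum_zJ_mul_of_notMem β (Or.inr rfl) g Jᶜ.toList (disjoint_empty_right J)
    fun x hx => by simpa using hx
  have h1 := cherPowSum_univ β (Or.inl rfl) Jᶜ
  have h2 := cherPowSum_univ β (Or.inr rfl) Jᶜ
  rw [compl_compl] at h1 h2
  rw [union_empty] at h
  conv_lhs => rw [cherPowSum_univ β (Or.inr rfl) J, LinearMap.add_apply, h,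
    cherPowSum_two_zJ_mul_of_mem β g J.toList (empty_subset J) fun x hx => by simpa using hx,
    union_empty, ← mul_add, length_toList]
  rw [h1, h2, LinearMap.add_apply, LinearMap.add_apply]
  congr 1
  module

theorem cherPowSum_one_DJ {f : MvPolynomial (Fin N) F} (hf : IsPermInvariant f)
    {J : Finset (Fin N)} (h0 : IsNull β (J.card + 1) f) (hJ : J.card < N) {L : List (Fin N)} :
    ∀ {S : Finset (Fin N)}, IsFresh S L → S ⊆ Jᶜ → (∀ x ∈ L, x ∉ J) →
      cherPowSum β 1 S L (DJ β 1 J f) =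
        (β * ∑ t ∈ range L.length, ((S.card + t : ℕ) : F)) • DJ β 1 J f := by
  induction L with
  | nil => intro S _ _ _; simp [cherPowSum]
  | cons a L ih =>
    intro S h hS hL
    have ha := hL a List.mem_cons_self
    have hK : ∑ l ∈ S, swapEnd l a (DJ β 1 J f) = (S.card : F) • DJ β 1 J f := by
      rw [Nat.cast_smul_eq_nsmul, ← sum_const]
      refine sum_congr rfl fun l hl => ?_
      rw [swapEnd, permEnd_DJ β hf _ hJ, image_swap_of_notMem (mem_compl.1 (hS hl)) ha]
    rw [cherPowSum, LinearMap.add_apply, pow_one,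
      ih h.tail (insert_subset (mem_compl.2 ha) hS) fun x hx => hL x (List.mem_cons_of_mem _ hx),
      cherednik, LinearMap.add_apply, LinearMap.smul_apply, LinearMap.sum_apply,
      dopEnd_DJ_eq_zero β hf h0 ha, hK, List.length_cons, sum_range_succ',
      card_insert_of_notMem h.head]
    simp only [add_zero, add_assoc, add_comm 1]
    module

theorem cherPowSum_DJ {p : ℕ} (hp : p = 1 ∨ p = 2) {f : MvPolynomial (Fin N) F}
    (hf : IsPermInvariant f) (hf' : IsPermInvariant (cherPowSum β p ∅ univ.toList f))
    {J : Finset (Fin N)} (hJ : J.card < N) :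
    cherPowSum β p ∅ univ.toList (DJ β 1 J f) =
      DJ β 1 J (cherPowSum β p ∅ univ.toList f) := by
  obtain ⟨b, hb⟩ := exists_notMem_of_card_lt hJ
  rw [DJ_eq_cherProd β hf hb, DJ_eq_cherProd β hf' hb, ← Module.End.mul_apply,
    ← (commute_cherProd_cherPowSum β hp (List.nodup_cons.2 ⟨by simpa using hb, sort_nodup _ _⟩)
      (nodup_toList _) (by simp)).eq, Module.End.mul_apply]

end Commutators

section Hamiltonian

variable {F : Type*} [Field F] {N : ℕ} (β : F)

theorem IsPermInvariant.sum_dopEnd_dopEnd {f : MvPolynomial (Fin N) F} (hf : IsPermInvariant f) :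
    IsPermInvariant (∑ a, dopEnd β a (dopEnd β a f)) := by
  intro σ
  have h : ∀ a, permEnd σ (dopEnd β a (dopEnd β a f)) = dopEnd β (σ a) (dopEnd β (σ a) f) :=
    fun a => by
      rw [← Module.End.mul_apply, permEnd_mul_dopEnd, Module.End.mul_apply,
        ← Module.End.mul_apply (permEnd σ), permEnd_mul_dopEnd, Module.End.mul_apply, hf]
  rw [map_sum, sum_congr rfl fun a _ => h a]
  exact Equiv.sum_comp σ fun a => dopEnd β a (dopEnd β a f)

theorem IsPermInvariant.add {f g : MvPolynomial (Fin N) F} (hf : IsPermInvariant f)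
    (hg : IsPermInvariant g) : IsPermInvariant (f + g) := fun σ => by
  rw [map_add, hf, hg]

theorem IsPermInvariant.smul {f : MvPolynomial (Fin N) F} (hf : IsPermInvariant f) (c : F) :
    IsPermInvariant (c • f) := fun σ => by
  rw [map_smul, hf]

theorem creationTerm_add_smul {f g : MvPolynomial (Fin N) F} (hf : IsPermInvariant f)
    (hg : IsPermInvariant g) (c : F) {J : Finset (Fin N)} (hJ : J.card < N) :
    creationTerm β J (f + c • g) = creationTerm β J f + c • creationTerm β J g := by
  obtain ⟨b, hb⟩ := exists_notMem_of_card_lt hJ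
  simp only [creationTerm]
  rw [DJ_eq_cherProd β (hf.add (hg.smul c)) hb, DJ_eq_cherProd β hf hb, DJ_eq_cherProd β hg hb,
    map_add, map_smul, mul_add, mul_smul_comm]

theorem creationTerm_smul {f : MvPolynomial (Fin N) F} (hf : IsPermInvariant f) (c : F)
    {J : Finset (Fin N)} (hJ : J.card < N) :
    creationTerm β J (c • f) = c • creationTerm β J f := by
  obtain ⟨b, hb⟩ := exists_notMem_of_card_lt hJ
  simp only [creationTerm]
  rw [DJ_eq_cherProd β (hf.smul c) hb, DJ_eq_cherProd β hf hb, map_smul, mul_smul_comm]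

theorem Bplus_smul {f : MvPolynomial (Fin N) F} (hf : IsPermInvariant f) (c : F) {i : ℕ}
    (hi : i < N) : Bplus β i univ (c • f) = c • Bplus β i univ f := by
  rw [Bplus_eq_sum, Bplus_eq_sum, smul_sum]
  refine sum_congr rfl fun J hJ => creationTerm_smul β hf c ?_
  rwa [mem_powersetCard_univ.1 hJ]

theorem dopEnd_eq_X_mul_pderiv {f : MvPolynomial (Fin N) F} (hf : IsPermInvariant f)
    (a : Fin N) : dopEnd β a f = X a * pderiv a f := by
  rw [dopEnd_apply, nablaEnd_apply, sum_eq_zero, smul_zero, add_zero]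
  exact fun j hj => divDiff_eq_zero (ne_of_mem_erase hj).symm (hf _)

theorem Aop_eq {f : MvPolynomial (Fin N) F} (hf : IsPermInvariant f) {i j : Fin N}
    (hij : i ≠ j) :
    Aop i j f = X i * divDiff i j (dopEnd β i f) + X j * divDiff j i (dopEnd β j f) := by
  have h : swapEnd i j (dopEnd β i f) = dopEnd β j f := by
    rw [swapEnd_comm]
    exact swapEnd_dopEnd_apply β hf j i
  have h' := sub_rename_swap hij (dopEnd β i f)
  rw [← divDiff_swap hij, ← swapEnd_apply, h] at h'
  rw [← divDiff_swap hij (dopEnd β i f), ← swapEnd_apply, h]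
  refine divExact_eq_of_eq_mul (X_sub_X_ne_zero hij) ?_
  rw [← dopEnd_eq_X_mul_pderiv β hf, ← dopEnd_eq_X_mul_pderiv β hf, h']
  ring

theorem sum_erase_eq_sum_filter_lt {M : Type*} [AddCommMonoid M] (t : Fin N → Fin N → M) :
    ∑ i, ∑ j ∈ univ.erase i, t i j =
      ∑ i, ∑ j ∈ univ.filter (fun j => i < j), (t i j + t j i) := by
  have h : ∀ i : Fin N, ∑ j ∈ univ.erase i, t i j =
      ∑ j ∈ univ.filter (fun j => i < j), t i j + ∑ j ∈ univ.filter (fun j => j < i), t i j := by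
    intro i
    rw [← sum_union]
    · refine sum_congr ?_ fun _ _ => rfl
      ext j
      simp only [mem_erase, mem_univ, and_true, mem_union, mem_filter, true_and]
      rw [lt_or_lt_iff_ne, ne_comm]
    · exact disjoint_filter.2 fun j _ h h' => lt_asymm h h'
  simp only [h, sum_add_distrib]
  congr 1
  exact sum_comm' fun x y => by simp

theorem Hop_eq_sum_dopEnd {f : MvPolynomial (Fin N) F} (hf : IsPermInvariant f) :
    Hop β univ f = ∑ a, dopEnd β a (dopEnd β a f) := by
  have h : ∀ a, dopEnd β a (dopEnd β a f) = X a * pderiv a (X a * pderiv a f)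
      + β • ∑ j ∈ univ.erase a, X a * divDiff a j (dopEnd β a f) := by
    intro a
    rw [dopEnd_apply, nablaEnd_apply, mul_add, mul_smul_comm, mul_sum]
    congr 3
    exact dopEnd_eq_X_mul_pderiv β hf a
  rw [sum_congr rfl fun a _ => h a, sum_add_distrib, ← smul_sum, sum_erase_eq_sum_filter_lt, Hop]
  congr 2
  exact sum_congr rfl fun i _ => sum_congr rfl fun j hj => Aop_eq β hf (mem_filter.1 hj).2.ne

theorem cherPowSum_one_univ {f : MvPolynomial (Fin N) F} (hf : IsPermInvariant f) :
    cherPowSum β 1 ∅ univ.toList f =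
      ∑ a, dopEnd β a f + (β * ∑ t ∈ range N, (t : F)) • f := by
  rw [cherPowSum_one_apply β hf (IsFresh.of_nodup (nodup_toList _)), sum_map_toList, length_toList,
    card_univ, Fintype.card_fin]
  simp

theorem cherPowSum_two_univ {f : MvPolynomial (Fin N) F} (hf : IsPermInvariant f) :
    cherPowSum β 2 ∅ univ.toList f =
      Hop β univ f + (β * ((N : F) - 1)) • ∑ a, dopEnd β a f
        + (∑ t ∈ range N, (β * (t : F)) ^ 2) • f := by
  rw [cherPowSum_two_apply β hf (IsFresh.of_nodup (nodup_toList _)), sum_map_toList,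
    sum_map_toList, length_toList, card_univ, Fintype.card_fin, Hop_eq_sum_dopEnd β hf]
  simp

theorem two_mul_sum_range_cast (n : ℕ) : 2 * ∑ t ∈ range n, (t : F) = n * (n - 1) := by
  induction n with
  | zero => simp
  | succ n ih =>
    rw [sum_range_succ, mul_add, ih]
    push_cast
    ring

/-- The polynomial is symmetric, homogeneous of degree `d` (in `F`) and annihilated by
products of `m` Cherednik operators. -/
structure IsState (m : ℕ) (d : F) (f : MvPolynomial (Fin N) F) : Prop where
  inv : IsPermInvariant f
  null : IsNull β m f
  euler : ∑ a, dopEnd β a f = d • f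

theorem cherPowSum_one_univ_DJ {i : ℕ} {d : F} {f : MvPolynomial (Fin N) F}
    (hf : IsState β (i + 1) d f) {J : Finset (Fin N)} (hJ : J.card = i) (hi : i < N) :
    cherPowSum β 1 ∅ univ.toList (DJ β 1 J f) = (d + β * ∑ t ∈ range N, (t : F)) • DJ β 1 J f := by
  have h1 : cherPowSum β 1 ∅ univ.toList f = (d + β * ∑ t ∈ range N, (t : F)) • f := by
    rw [cherPowSum_one_univ β hf.inv, hf.euler, add_smul]
  have hJN : J.card < N := hJ ▸ hi
  obtain ⟨b, hb⟩ := exists_notMem_of_card_lt hJN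
  rw [cherPowSum_DJ β (Or.inl rfl) hf.inv (h1 ▸ hf.inv.smul _) hJN, h1,
    DJ_eq_cherProd β (hf.inv.smul _) hb, DJ_eq_cherProd β hf.inv hb, map_smul]

theorem IsState.Bplus {i : ℕ} {d : F} {f : MvPolynomial (Fin N) F} (hf : IsState β (i + 1) d f)
    (hi : i < N) : IsState β (i + 1) (d + i) (Bplus β i univ f) where
  inv := hf.inv.Bplus β hi
  null := hf.null.Bplus β hf.inv hi
  euler := by
    have h := cherPowSum_one_univ β (hf.inv.Bplus β hi)
    rw [Bplus_eq_sum, map_sum, sum_congr rfl fun J hJ => by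
      rw [creationTerm, cherPowSum_one_zJ_mul, cherPowSum_one_univ_DJ β hf
        (mem_powersetCard_univ.1 hJ) hi, mem_powersetCard_univ.1 hJ, ← add_smul, mul_smul_comm,
        ← creationTerm], ← smul_sum, ← Bplus_eq_sum] at h
    rw [← sub_eq_iff_eq_add.2 h]
    module

theorem Hop_Bplus_sub_Bplus_Hop {i : ℕ} {d : F} {f : MvPolynomial (Fin N) F}
    (hf : IsState β (i + 1) d f) (hi : i < N) :
    Hop β univ (Bplus β i univ f) - Bplus β i univ (Hop β univ f) =
      (2 * d + i + β * i * ((N - i : ℕ) : F)) • Bplus β i univ f := by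
  set τ : ℕ → F := fun n => ∑ t ∈ range n, (t : F) with hτ
  set c : F := ∑ t ∈ range N, (β * (t : F)) ^ 2
  have hH : IsPermInvariant (Hop β univ f) := by
    rw [Hop_eq_sum_dopEnd β hf.inv]
    exact hf.inv.sum_dopEnd_dopEnd β
  have h2 : cherPowSum β 2 ∅ univ.toList f = Hop β univ f + (β * ((N : F) - 1) * d + c) • f := by
    rw [cherPowSum_two_univ β hf.inv, hf.euler]
    module
  have hterm : ∀ J ∈ powersetCard i (univ : Finset (Fin N)),
      cherPowSum β 2 ∅ univ.toList (creationTerm β J f) = creationTerm β J (Hop β univ f)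
        + (β * ((N : F) - 1) * d + c + 2 * (d + β * τ N - β * τ (N - i)) + i) •
          creationTerm β J f := by
    intro J hJ
    rw [mem_powersetCard_univ] at hJ
    have hJN : J.card < N := hJ ▸ hi
    have hc : cherPowSum β 1 ∅ Jᶜ.toList (DJ β 1 J f) = (β * τ (N - i)) • DJ β 1 J f := by
      rw [cherPowSum_one_DJ β hf.inv (hJ ▸ hf.null) hJN (IsFresh.of_nodup (nodup_toList _))
        (empty_subset _) fun x hx => by simpa using hx, length_toList, card_compl,
        Fintype.card_fin, hJ]
      simp [hτ]
    have hD := creationTerm_add_smul β hH hf.inv (β * ((N : F) - 1) * d + c) hJN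
    rw [← h2, creationTerm, ← cherPowSum_DJ β (Or.inr rfl) hf.inv
      (h2 ▸ hH.add (hf.inv.smul _)) hJN] at hD
    rw [creationTerm, cherPowSum_two_zJ_mul, mul_add, mul_add, hD, hc,
      cherPowSum_one_univ_DJ β hf hJ hi, hJ, ← sub_smul, smul_smul, mul_smul_comm,
      mul_smul_comm, ← creationTerm]
    module
  have hW := cherPowSum_two_univ β (hf.Bplus β hi).inv
  rw [(hf.Bplus β hi).euler] at hW
  have hW' : cherPowSum β 2 ∅ univ.toList (Bplus β i univ f) = Bplus β i univ (Hop β univ f)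
      + (β * ((N : F) - 1) * d + c + 2 * (d + β * τ N - β * τ (N - i)) + i) •
        Bplus β i univ f := by
    rw [Bplus_eq_sum, map_sum, sum_congr rfl hterm, sum_add_distrib, ← smul_sum]
    rfl
  have hcast : ((N - i : ℕ) : F) = N - i := Nat.cast_sub hi.le
  have hcoef : (2 * d + i + β * i * ((N - i : ℕ) : F)) =
      (β * ((N : F) - 1) * d + c + 2 * (d + β * τ N - β * τ (N - i)) + i)
        - (β * ((N : F) - 1) * (d + i) + c) := by
    have h1 := two_mul_sum_range_cast (F := F) N
    have h2 := two_mul_sum_range_cast (F := F) (N - i)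
    rw [hcast] at *
    linear_combination β * h2 - β * h1
  rw [hcoef]
  rw [hW, ← sub_eq_iff_eq_add] at hW'
  rw [← hW']
  module

end Hamiltonian

section States

variable {F : Type*} [Field F] {N : ℕ} (β : F)

theorem isState_one : IsState β 1 0 (1 : MvPolynomial (Fin N) F) where
  inv σ := map_one (rename σ)
  null L hL hlen := by
    obtain ⟨a, rfl⟩ := List.length_eq_one_iff.1 hlen
    rw [cherProd, cherProd, mul_one, cherednik, sum_empty, smul_zero, add_zero, dopEnd_apply,
      nablaEnd_one, mul_zero]
  euler := by
    simp [dopEnd_apply, nablaEnd_one]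

theorem isState_iterate_Bplus {i : ℕ} {d : F} {f : MvPolynomial (Fin N) F}
    (hf : IsState β (i + 1) d f) (hi : i < N) (n : ℕ) :
    IsState β (i + 1) (d + ((n * i : ℕ) : F)) ((fun f => Bplus β i univ f)^[n] f) := by
  induction n with
  | zero => simpa using hf
  | succ n ih =>
    rw [Function.iterate_succ_apply', add_mul, one_mul, Nat.cast_add, ← add_assoc]
    exact ih.Bplus β hi

theorem isState_phiCS (lam : ℕ → ℕ) {k : ℕ} (hk : k < N) :
    IsState β (k + 1) ((∑ j ∈ range k, (lam j - lam (j + 1)) * (j + 1) : ℕ) : F)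
      (phiCS β N lam k) := by
  induction k with
  | zero => simpa [phiCS] using isState_one β
  | succ k ih =>
    have h := ih (by omega)
    rw [sum_range_succ, Nat.cast_add, phiCS]
    exact isState_iterate_Bplus β ⟨h.inv, h.null.succ, h.euler⟩ hk _

theorem sum_range_sub_mul {lam : ℕ → ℕ} (hmono : Antitone lam) (k : ℕ) :
    ∑ j ∈ range k, (lam j - lam (j + 1)) * (j + 1) + k * lam k = ∑ j ∈ range k, lam j := by
  induction k with
  | zero => simp
  | succ k ih =>
    obtain ⟨m, hm⟩ := Nat.exists_eq_add_of_le (hmono k.le_succ)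
    rw [sum_range_succ, sum_range_succ, ← ih, hm, Nat.add_sub_cancel_left]
    ring

theorem phiCS_eq_of_le {lam : ℕ → ℕ} {i : ℕ} (hzero : ∀ j, i ≤ j → lam j = 0) {k : ℕ}
    (hk : i ≤ k) : phiCS β N lam k = phiCS β N lam i := by
  induction k, hk using Nat.le_induction with
  | base => rfl
  | succ k hk ih =>
    rw [phiCS, hzero k hk, Nat.zero_sub, Function.iterate_zero, id, ih]

end States

/-- `[H, B⁺_i] φ_λ = B⁺_i (2 ∑_{j=1}^{N-1} λ_j + i + β i (N-i)) φ_λ`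
for partitions `λ` with `λ_{i+1} = … = λ_{N-1} = 0` (`lam` 0-indexed). -/
theorem statement_5 {F : Type*} [Field F] [CharZero F] {N : ℕ} (β : F) (i : ℕ)
    (hi1 : 1 ≤ i) (hiN : i ≤ N - 1)
    (lam : ℕ → ℕ) (hmono : ∀ a b : ℕ, a ≤ b → lam b ≤ lam a)
    (hzero : ∀ j, i ≤ j → lam j = 0) :
    Hop β Finset.univ (Bplus β i Finset.univ (phiCS β N lam (N - 1)))
      - Bplus β i Finset.univ (Hop β Finset.univ (phiCS β N lam (N - 1)))
    = Bplus β i Finset.univ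
        ((2 * (∑ j ∈ Finset.range (N - 1), (lam j : F)) + (i : F) + β * (i : F) * ((N - i : ℕ) : F))
          • phiCS β N lam (N - 1)) := by
  have hN : i < N := by omega
  have hsum : ∑ j ∈ range (N - 1), lam j = ∑ j ∈ range i, lam j :=
    (sum_subset (range_subset_range.2 hiN) fun j _ hj => hzero j (by simpa using hj)).symm
  have hstate := isState_phiCS β lam hN
  have hd := sum_range_sub_mul (fun a b h => hmono a b h) i
  rw [hzero i le_rfl, mul_zero, add_zero] at hd
  rw [hd] at hstate
  rw [phiCS_eq_of_le β hzero hiN, Hop_Bplus_sub_Bplus_Hop β hstate hN,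
    Bplus_smul β hstate.inv _ hN, ← Nat.cast_sum, hsum]
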